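/- Let T = (V,E) be an infinite rooted tree of bounded degree, let b ∈ [0,1), and define Q on ℓ²(V) by Qf(v) = ∑_{w : π(w)=v} f(w). If b² · maxgr T > 1, where maxgr T = limsup_{r→∞} sup_{v∈V} |D_r(v)|^{1/r}, then the ℓ² operator norms ‖∑_{j=0}^k (bQ)^j‖ tend to infinity as k → ∞. -/

import Mathlib

open MeasureTheory ProbabilityTheory Filter Topology
open scoped ENNReal NNReal

/-- A rooted tree on vertex type `V`, encoded by its root and parent function:
every vertex reaches the root by iterating `parent`, and the root is a fixed
point of `parent`. -/
structure ParentTree (V : Type*) where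
  root : V
  parent : V → V
  parent_root : parent root = root
  reaches_root : ∀ v : V, ∃ n : ℕ, parent^[n] v = root

namespace ParentTree

variable {V : Type*} (T : ParentTree V)

/-- The depth of a vertex: its graph distance to the root. -/
noncomputable def depth (v : V) : ℕ := sInf {n : ℕ | T.parent^[n] v = T.root}

lemma depth_spec (v : V) : T.parent^[T.depth v] v = T.root :=
  Nat.sInf_mem (T.reaches_root v)

lemma depth_root : T.depth T.root = 0 :=
  Nat.eq_zero_of_le_zero (Nat.sInf_le (by simp))

lemma depth_parent_le (v : V) : T.depth (T.parent v) ≤ T.depth v := by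
  have hspec := T.depth_spec v
  cases h : T.depth v with
  | zero =>
      rw [h] at hspec
      simp only [Function.iterate_zero, id_eq] at hspec
      subst hspec
      simp [T.parent_root, T.depth_root]
  | succ m =>
      rw [h, Function.iterate_succ_apply] at hspec
      exact (Nat.sInf_le hspec).trans (Nat.le_succ m)

/-- `Desc T r v` is the set of descendants of `v` exactly `r` generations below `v`. -/
def Desc (r : ℕ) (v : V) : Set V :=
  {w : V | T.parent^[r] w = v ∧ T.depth w = T.depth v + r}

/-- The set of children of a vertex. -/
def children (v : V) : Set V := {w : V | w ≠ T.root ∧ T.parent w = v}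

/-- The graph distance between two vertices of the tree. -/
noncomputable def tdist (v w : V) : ℕ :=
  sInf {k : ℕ | ∃ n m : ℕ, n + m = k ∧ T.parent^[n] v = T.parent^[m] w}

/-- The descendant generating function `δ(v) = ∑_r |D_r(v)| bʳ`. -/
noncomputable def dgf (b : ℝ) (v : V) : ℝ :=
  ∑' r : ℕ, (Nat.card (T.Desc r v) : ℝ) * b ^ r

/-- `Δ = ‖δ‖_{ℓ²(V)}` for a finite tree. -/
noncomputable def Delta [Fintype V] (b : ℝ) : ℝ :=
  Real.sqrt (∑ v : V, T.dgf b v ^ 2)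

/-- Upper growth rate `limsup_r |D_r(ρ)|^{1/r}`. -/
noncomputable def bargr : ℝ≥0∞ :=
  Filter.atTop.limsup fun r : ℕ => (Nat.card (T.Desc r T.root) : ℝ≥0∞) ^ (1 / (r : ℝ))

/-- Maximum local growth rate `limsup_r max_v |D_r(v)|^{1/r}`. -/
noncomputable def maxgr : ℝ≥0∞ :=
  Filter.atTop.limsup fun r : ℕ => ⨆ v : V, (Nat.card (T.Desc r v) : ℝ≥0∞) ^ (1 / (r : ℝ))

/-- The parent map of the depth-`k` truncation. -/
noncomputable def truncParent (k : ℕ) (v : {v : V // T.depth v ≤ k}) :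
    {v : V // T.depth v ≤ k} :=
  ⟨T.parent v.1, le_trans (T.depth_parent_le v.1) v.2⟩

lemma truncParent_iterate (k n : ℕ) (v : {v : V // T.depth v ≤ k}) :
    ((T.truncParent k)^[n] v).1 = T.parent^[n] v.1 := by
  induction n generalizing v with
  | zero => rfl
  | succ n ih =>
      rw [Function.iterate_succ_apply, Function.iterate_succ_apply]
      exact ih _

/-- The subtree induced by the vertices within distance `k` of the root. -/
noncomputable def trunc (k : ℕ) : ParentTree {v : V // T.depth v ≤ k} where
  root := ⟨T.root, by simp [T.depth_root]⟩
  parent := T.truncParent k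
  parent_root := Subtype.ext T.parent_root
  reaches_root := fun v => by
    obtain ⟨n, hn⟩ := T.reaches_root v.1
    exact ⟨n, Subtype.ext (by rw [truncParent_iterate, hn])⟩

end ParentTree

namespace ParentTree

variable {V : Type*} (T : ParentTree V)

lemma depth_eq_depth_parent_add_one {w : V} (hw : w ≠ T.root) :
    T.depth w = T.depth (T.parent w) + 1 := by
  apply le_antisymm
  · refine Nat.sInf_le ?_
    change T.parent^[T.depth (T.parent w) + 1] w = T.root
    rw [Function.iterate_succ_apply]
    exact T.depth_spec _
  · have hspec := T.depth_spec w
    cases h : T.depth w with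
    | zero =>
        rw [h] at hspec
        exact absurd hspec hw
    | succ m =>
        rw [h, Function.iterate_succ_apply] at hspec
        exact Nat.succ_le_succ (Nat.sInf_le hspec)

lemma ne_root_of_mem_Desc_succ {r : ℕ} {v w : V} (h : w ∈ T.Desc (r + 1) v) : w ≠ T.root := by
  rintro rfl
  have := h.2
  rw [T.depth_root] at this
  omega

lemma parent_mem_Desc {r : ℕ} {v w : V} (h : w ∈ T.Desc (r + 1) v) :
    T.parent w ∈ T.Desc r v := by
  have hd := T.depth_eq_depth_parent_add_one (T.ne_root_of_mem_Desc_succ h)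
  refine ⟨h.1, ?_⟩
  have := h.2
  omega

/-- If `b² · maxgr T > 1`, then `b²ʳ |D_r(v)|` grows exponentially along suitable `r`, `v`. -/
lemma exists_frequently_pow_lt_card_Desc {b : ℝ}
    (hgr : 1 < ENNReal.ofReal (b ^ 2) * T.maxgr) :
    ∃ c : ℝ, 1 < c ∧ ∃ᶠ r : ℕ in atTop, ∃ v : V,
      c ^ r < (b ^ 2) ^ r * (Nat.card (T.Desc r v) : ℝ) := by
  rw [maxgr, ← ENNReal.limsup_const_mul_of_ne_top ENNReal.ofReal_ne_top] at hgr
  obtain ⟨c, hc1, hc⟩ := ENNReal.lt_iff_exists_nnreal_btwn.1 hgr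
  refine ⟨c, by exact_mod_cast hc1, ?_⟩
  refine ((frequently_lt_of_lt_limsup (by isBoundedDefault) hc).and_eventually
    (eventually_gt_atTop 0)).mono ?_
  rintro r ⟨hr, hr0⟩
  rw [ENNReal.mul_iSup] at hr
  obtain ⟨v, hv⟩ := lt_iSup_iff.1 hr
  refine ⟨v, ?_⟩
  have hpow := ENNReal.pow_right_strictMono hr0.ne' hv
  simp only [mul_pow] at hpow
  rw [← ENNReal.rpow_natCast ((Nat.card (T.Desc r v) : ℝ≥0∞) ^ _) r, ← ENNReal.rpow_mul,
    one_div_mul_cancel (by exact_mod_cast hr0.ne'), ENNReal.rpow_one] at hpow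
  have h := (ENNReal.toReal_lt_toReal (by finiteness) (by finiteness)).2 hpow
  simpa [ENNReal.toReal_ofReal (sq_nonneg b)] using h

lemma childSum_pow_nonneg {Q : lp (fun _ : V => ℝ) 2 →L[ℝ] lp (fun _ : V => ℝ) 2}
    (hQ : ∀ (f : lp (fun _ : V => ℝ) 2) (v : V),
      (Q f : ∀ _ : V, ℝ) v = ∑' w : T.children v, (f : ∀ _ : V, ℝ) ↑w)
    {f : lp (fun _ : V => ℝ) 2} (hf : ∀ v, 0 ≤ f v) (j : ℕ) (v : V) : 0 ≤ (Q ^ j) f v := by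
  induction j generalizing v with
  | zero => exact hf v
  | succ j ih =>
      rw [pow_succ', mul_apply_eq_comp, hQ]
      exact tsum_nonneg fun w => ih w

lemma childSum_single [DecidableEq V] {Q : lp (fun _ : V => ℝ) 2 →L[ℝ] lp (fun _ : V => ℝ) 2}
    (hQ : ∀ (f : lp (fun _ : V => ℝ) 2) (v : V),
      (Q f : ∀ _ : V, ℝ) v = ∑' w : T.children v, (f : ∀ _ : V, ℝ) ↑w)
    {w : V} (hw : w ≠ T.root) :
    Q (lp.single 2 w (1 : ℝ)) = lp.single 2 (T.parent w) (1 : ℝ) := by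
  ext v
  rw [hQ]
  by_cases hv : v = T.parent w
  · subst hv
    rw [tsum_eq_single (⟨w, hw, rfl⟩ : T.children (T.parent w))]
    · simp
    · rintro ⟨x, hx⟩ hne
      have hxw : x ≠ w := fun h => hne (Subtype.ext h)
      simp [lp.single_apply, hxw]
  · rw [lp.single_apply_ne _ _ _ hv]
    refine (tsum_congr fun x => ?_).trans tsum_zero
    have hxw : (x : V) ≠ w := fun h => hv (by rw [← h, x.2.2])
    simp [lp.single_apply, hxw]

lemma childSum_pow_single [DecidableEq V] {Q : lp (fun _ : V => ℝ) 2 →L[ℝ] lp (fun _ : V => ℝ) 2}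
    (hQ : ∀ (f : lp (fun _ : V => ℝ) 2) (v : V),
      (Q f : ∀ _ : V, ℝ) v = ∑' w : T.children v, (f : ∀ _ : V, ℝ) ↑w)
    {r : ℕ} {v w : V} (hw : w ∈ T.Desc r v) :
    (Q ^ r) (lp.single 2 w (1 : ℝ)) = lp.single 2 v (1 : ℝ) := by
  induction r generalizing w with
  | zero =>
      obtain rfl : w = v := hw.1
      rfl
  | succ r ih =>
      rw [pow_succ, mul_apply_eq_comp,
        T.childSum_single hQ (T.ne_root_of_mem_Desc_succ hw), ih (T.parent_mem_Desc hw)]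

lemma pow_mul_card_Desc_le_opNorm_sq {Q : lp (fun _ : V => ℝ) 2 →L[ℝ] lp (fun _ : V => ℝ) 2}
    (hQ : ∀ (f : lp (fun _ : V => ℝ) 2) (v : V),
      (Q f : ∀ _ : V, ℝ) v = ∑' w : T.children v, (f : ∀ _ : V, ℝ) ↑w)
    {b : ℝ} (hb0 : 0 ≤ b) {r k : ℕ} (hrk : r ≤ k) (v : V) :
    (b ^ 2) ^ r * (Nat.card (T.Desc r v) : ℝ) ≤
      ‖∑ j ∈ Finset.range (k + 1), (b • Q) ^ j‖ ^ 2 := by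
  classical
  rcases Nat.eq_zero_or_pos (Nat.card (T.Desc r v)) with h0 | hpos
  · rw [h0]
    simp
  have hfin : (T.Desc r v).Finite := (Nat.card_pos_iff.1 hpos).2
  set n := Nat.card (T.Desc r v) with hn
  have hcard : hfin.toFinset.card = n := by
    rw [hn, Nat.card_coe_set_eq, Set.ncard_eq_toFinset_card _ hfin]
  set S := ∑ j ∈ Finset.range (k + 1), (b • Q) ^ j with hS
  set f : lp (fun _ : V => ℝ) 2 := ∑ w ∈ hfin.toFinset, lp.single 2 w (1 : ℝ) with hf
  have hf_norm : ‖f‖ ^ 2 = n := by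
    have h := lp.norm_sum_single (p := 2) (E := fun _ : V => ℝ) (by norm_num)
      (fun _ => (1 : ℝ)) hfin.toFinset
    simpa [← hf, hcard] using h
  have hf_nonneg : ∀ u, 0 ≤ f u := by
    intro u
    rw [hf, lp.coeFn_sum, Finset.sum_apply]
    refine Finset.sum_nonneg fun w _ => ?_
    rw [lp.single_apply, Pi.single_apply]
    split_ifs <;> norm_num
  have hQf : (Q ^ r) f v = n := by
    rw [hf, map_sum, Finset.sum_congr rfl fun w hw =>
      T.childSum_pow_single hQ (hfin.mem_toFinset.1 hw), Finset.sum_const, hcard]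
    simp
  have hSf : b ^ r * n ≤ S f v := by
    have hSv : S f v = ∑ j ∈ Finset.range (k + 1), b ^ j * (Q ^ j) f v := by
      rw [hS, sum_apply, lp.coeFn_sum, Finset.sum_apply]
      simp [smul_pow]
    rw [hSv, ← hQf]
    exact Finset.single_le_sum (f := fun j => b ^ j * (Q ^ j) f v)
      (fun j _ => mul_nonneg (pow_nonneg hb0 j) (T.childSum_pow_nonneg hQ hf_nonneg j v))
      (Finset.mem_range.2 (Nat.lt_succ_of_le hrk))
  have hle : b ^ r * n ≤ ‖S‖ * ‖f‖ :=
    calc b ^ r * n ≤ S f v := hSf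
      _ ≤ ‖S f v‖ := Real.le_norm_self _
      _ ≤ ‖S f‖ := lp.norm_apply_le_norm two_ne_zero _ _
      _ ≤ ‖S‖ * ‖f‖ := S.le_opNorm f
  have hn0 : (0 : ℝ) < n := by exact_mod_cast hpos
  have hsq := pow_le_pow_left₀ (by positivity) hle 2
  rw [mul_pow ‖S‖, hf_norm] at hsq
  refine le_of_mul_le_mul_right ?_ hn0
  calc (b ^ 2) ^ r * n * n = (b ^ r * n) ^ 2 := by ring
    _ ≤ ‖S‖ ^ 2 * n := hsq

end ParentTree

/-- **Proposition (blow-up of the operator-norm bound).** Let `T` be an infinite rooted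
tree of bounded degree, `b ∈ [0,1)`, and `Q` the bounded operator on `ℓ²(V)` given by
`Qf(v) = ∑_{w child of v} f(w)`. If `b²·maxgr T > 1`, then
`‖∑_{j=0}^k (bQ)^j‖ → ∞` as `k → ∞`. -/
theorem opNorm_partial_sums_tendsto_atTop
    {V : Type} [Infinite V] (T : ParentTree V)
    (hdeg : ∃ d : ℕ, ∀ v : V, (T.children v).Finite ∧ Nat.card (T.children v) ≤ d)
    {b : ℝ} (hb0 : 0 ≤ b) (hb1 : b < 1)
    (hgr : 1 < ENNReal.ofReal (b ^ 2) * T.maxgr)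
    (Q : lp (fun _ : V => ℝ) 2 →L[ℝ] lp (fun _ : V => ℝ) 2)
    (hQ : ∀ (f : lp (fun _ : V => ℝ) 2) (v : V),
      (Q f : ∀ _ : V, ℝ) v = ∑' w : T.children v, (f : ∀ _ : V, ℝ) ↑w) :
    Filter.Tendsto (fun k : ℕ => ‖∑ j ∈ Finset.range (k + 1), (b • Q) ^ j‖)
      Filter.atTop Filter.atTop := by
  obtain ⟨c, hc, hfreq⟩ := T.exists_frequently_pow_lt_card_Desc hgr
  refine tendsto_atTop.2 fun M => ?_
  obtain ⟨r, hM, v, hv⟩ :=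
    ((tendsto_pow_atTop_atTop_of_one_lt hc).eventually_ge_atTop (M ^ 2)).and_frequently hfreq
      |>.exists
  filter_upwards [eventually_ge_atTop r] with k hk
  refine le_of_abs_le (abs_le_of_sq_le_sq ?_ (norm_nonneg _))
  exact hM.trans (hv.le.trans (T.pow_mul_card_Desc_le_opNorm_sq hQ hb0 hk v))
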